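/- Suppose q = d and for every k and x the matrix σ(t_k,x) is diagonal with positive diagonal entries σ_k^{ℓℓ}(x) > 0. Then for every 0 ≤ k ≤ n−1, every i ∈ I_k with P(X̂_k = x_k^i) > 0 and every j ∈ I_{k+1}, the transition probabilities of the Markovian product quantization factorize: P( X̂_{k+1} = x_{k+1}^j | X̂_k = x_k^i ) = Π_{ℓ=1}^d P( X̂_{k+1}^ℓ = x_{k+1}^{ℓ,j_ℓ} | X̂_k = x_k^i ) = Π_{ℓ=1}^d [ Φ_0( (x_{k+1}^{ℓ,j_ℓ+1/2} − m_k^ℓ(x_k^i)) / (√Δ σ_k^{ℓℓ}(x_k^i)) ) − Φ_0( (x_{k+1}^{ℓ,j_ℓ−1/2} − m_k^ℓ(x_k^i)) / (√Δ σ_k^{ℓℓ}(x_k^i)) ) ]. Consequently, P( X̂_{k+1} = x_{k+1}^j ) = Σ_{i ∈ I_k} Π_{ℓ=1}^d [ Φ_0( (x_{k+1}^{ℓ,j_ℓ+1/2} − m_k^ℓ(x_k^i)) / (√Δ σ_k^{ℓℓ}(x_k^i)) ) − Φ_0( (x_{k+1}^{ℓ,j_ℓ−1/2} − m_k^ℓ(x_k^i))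 / (√Δ σ_k^{ℓℓ}(x_k^i)) ) ] · P(X̂_k = x_k^i). -/

import Mathlib

open MeasureTheory ProbabilityTheory Real Set
open scoped ENNReal NNReal Classical

noncomputable section

namespace MPQ

/-- Standard normal cumulative distribution function `Φ₀`. -/
def Phi0 (x : ℝ) : ℝ := ((gaussianReal 0 1) (Set.Iic x)).toReal

/-- `Φ₀` extended to `EReal`, with `Φ₀(−∞) = 0` and `Φ₀(+∞) = 1`. -/
def Phi0E (x : EReal) : ℝ := if x = ⊥ then 0 else if x = ⊤ then 1 else Phi0 x.toReal

/-- Standard normal density `Φ₀'` extended to `EReal`, vanishing at `±∞`. -/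
def phi0E (x : EReal) : ℝ := if x = ⊥ ∨ x = ⊤ then 0 else gaussianPDFReal 0 1 x.toReal

/-- `a ↦ a·Φ₀'(a)` extended to `EReal`, with the convention that it vanishes at `±∞`. -/
def idphi0E (x : EReal) : ℝ :=
  if x = ⊥ ∨ x = ⊤ then 0 else x.toReal * gaussianPDFReal 0 1 x.toReal

/-- The affine renormalisation `c ↦ (c − m)/v` on `EReal` (taking the sign of `v` into
account at `±∞`). -/
def affE (c : EReal) (m v : ℝ) : EReal :=
  if c = ⊤ then (if v < 0 then ⊥ else ⊤)
  else if c = ⊥ then (if v < 0 then ⊤ else ⊥)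
  else (((c.toReal - m) / v : ℝ) : EReal)

/-- Lower half-point `x^{j−1/2}` of the `j`-th Voronoi cell (0-based indexing) of the
grid `g`, with `x^{-1/2} = −∞`. -/
def lo (g : ℕ → ℝ) (j : ℕ) : EReal :=
  if j = 0 then ⊥ else (((g (j - 1) + g j) / 2 : ℝ) : EReal)

/-- Upper half-point `x^{j+1/2}` of the `j`-th Voronoi cell (0-based indexing) of a grid
`g` of size `m`, with the last one equal to `+∞`. -/
def hi (m : ℕ) (g : ℕ → ℝ) (j : ℕ) : EReal :=
  if j + 1 = m then ⊤ else (((g j + g (j + 1)) / 2 : ℝ) : EReal)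

/-- The `j`-th Voronoi cell of a (sorted) grid `g` of size `m`. -/
def cell (m : ℕ) (g : ℕ → ℝ) (j : ℕ) : Set ℝ :=
  {y : ℝ | lo g j < (y : EReal) ∧ (y : EReal) < hi m g j}

/-- Distance from `ξ` to a grid `g` of size `m`. -/
def distToGrid (m : ℕ) (g : ℕ → ℝ) (ξ : ℝ) : ℝ :=
  sInf ((fun j => |ξ - g j|) '' {j | j < m})

/-- Euclidean norm on `Fin d → ℝ`. -/
def enorm2 {d : ℕ} (x : Fin d → ℝ) : ℝ := Real.sqrt (∑ ℓ, (x ℓ) ^ 2)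

/-- Frobenius norm of a `d × q` matrix. -/
def fnorm {d q : ℕ} (a : Fin d → Fin q → ℝ) : ℝ := Real.sqrt (∑ ℓ, ∑ p, (a ℓ p) ^ 2)

/-- The standard Gaussian distribution `N(0; I_m)` on `ℝ^m`. -/
def gaussPi (m : ℕ) : Measure (Fin m → ℝ) := Measure.pi fun _ => gaussianReal 0 1

/-- The probability of an event, as a real number. -/
def pr {Ω : Type*} [MeasureSpace Ω] (A : Set Ω) : ℝ := (ℙ A).toReal

/-- The conditional probability `P(A | B) = P(A ∩ B)/P(B)`. -/
def condPr {Ω : Type*} [MeasureSpace Ω] (A B : Set Ω) : ℝ := pr (A ∩ B) / pr B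

end MPQ

open MPQ

namespace MPQ

theorem phi0E_eq_measureReal_lt (e : EReal) :
    Phi0E e = (gaussianReal 0 1).real {z : ℝ | (z : EReal) < e} := by
  induction e with
  | bot => simp [Phi0E]
  | top => simp [Phi0E, EReal.coe_lt_top]
  | coe x =>
    have : NullSingletonClass (gaussianReal 0 1) := nullSingletonClass_gaussianReal one_ne_zero
    simp only [Phi0E, EReal.coe_ne_bot, EReal.coe_ne_top, if_false, EReal.toReal_coe,
      EReal.coe_lt_coe_iff, Phi0]
    exact (measureReal_congr (Iio_ae_eq_Iic (μ := gaussianReal 0 1) (a := x))).symm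

theorem phi0E_eq_measureReal_le (e : EReal) (he : e ≠ ⊤) :
    Phi0E e = (gaussianReal 0 1).real {z : ℝ | (z : EReal) ≤ e} := by
  induction e with
  | bot => simp [Phi0E]
  | top => exact absurd rfl he
  | coe x =>
    simp only [Phi0E, EReal.coe_ne_bot, EReal.coe_ne_top, if_false, EReal.toReal_coe,
      EReal.coe_le_coe_iff, Phi0]
    rfl

theorem coe_lt_affE_iff (c : EReal) (m : ℝ) {v : ℝ} (hv : 0 < v) (z : ℝ) :
    (z : EReal) < affE c m v ↔ ((m + v * z : ℝ) : EReal) < c := by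
  induction c with
  | bot => simp [affE, hv.not_gt]
  | top => simpa [affE, hv.not_gt] using EReal.coe_lt_top (m + v * z)
  | coe x =>
    simp only [affE, EReal.coe_ne_bot, EReal.coe_ne_top, if_false, EReal.toReal_coe,
      EReal.coe_lt_coe_iff]
    rw [lt_div_iff₀ hv]
    constructor <;> intro h <;> linarith

theorem coe_le_affE_iff (c : EReal) (m : ℝ) {v : ℝ} (hv : 0 < v) (z : ℝ) :
    (z : EReal) ≤ affE c m v ↔ ((m + v * z : ℝ) : EReal) ≤ c := by
  induction c with
  | bot => simp [affE, hv.not_gt, -EReal.coe_add, -EReal.coe_mul]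
  | top => simp [affE, hv.not_gt]
  | coe x =>
    simp only [affE, EReal.coe_ne_bot, EReal.coe_ne_top, if_false, EReal.toReal_coe,
      EReal.coe_le_coe_iff]
    rw [le_div_iff₀ hv]
    constructor <;> intro h <;> linarith

theorem affE_ne_top {c : EReal} (hc : c ≠ ⊤) (m : ℝ) {v : ℝ} (hv : 0 < v) : affE c m v ≠ ⊤ := by
  induction c with
  | bot => simp [affE, hv.not_gt]
  | top => exact absurd rfl hc
  | coe x =>
    simp only [affE, EReal.coe_ne_bot, EReal.coe_ne_top, if_false]
    exact EReal.coe_ne_top _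

theorem lo_ne_top (g : ℕ → ℝ) (j : ℕ) : lo g j ≠ ⊤ := by
  unfold lo
  split_ifs
  · simp
  · exact EReal.coe_ne_top _

theorem lo_lt_hi {N : ℕ} {g : ℕ → ℝ} (hg : StrictMonoOn g {j | j < N}) {j : ℕ} (hj : j < N) :
    lo g j < hi N g j := by
  unfold lo hi
  split_ifs with h0 h1 h1
  · simp
  · exact EReal.bot_lt_coe _
  · exact EReal.coe_lt_top _
  · rw [EReal.coe_lt_coe_iff]
    have h2 : g (j - 1) < g j := hg (show j - 1 < N by omega) hj (by omega)
    have h3 : g j < g (j + 1) := hg hj (show j + 1 < N by omega) (by omega)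
    linarith

/-- The Gaussian mass of a Voronoi cell of a sorted grid under `z ↦ m + v z`. -/
theorem gaussianReal_affine_cell {N : ℕ} {g : ℕ → ℝ} (hg : StrictMonoOn g {j | j < N}) {j : ℕ}
    (hj : j < N) (m : ℝ) {v : ℝ} (hv : 0 < v) :
    (gaussianReal 0 1).real {z : ℝ | m + v * z ∈ cell N g j}
      = Phi0E (affE (hi N g j) m v) - Phi0E (affE (lo g j) m v) := by
  rw [phi0E_eq_measureReal_lt,
    phi0E_eq_measureReal_le _ (affE_ne_top (lo_ne_top g j) m hv), ← measureReal_sdiff]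
  · congr 1
    ext z
    simp only [cell, mem_ofPred_eq, mem_sdiff, coe_lt_affE_iff _ _ hv, coe_le_affE_iff _ _ hv,
      not_le]
    exact and_comm
  · intro z hz
    simp only [mem_ofPred_eq, coe_lt_affE_iff _ _ hv, coe_le_affE_iff _ _ hv] at hz ⊢
    exact hz.trans_lt (lo_lt_hi hg hj)
  · exact measurableSet_le measurable_coe_real_ereal measurable_const

/-- A real number which is not a half-point of the grid lies in one of the Voronoi cells. -/
theorem exists_mem_cell {N : ℕ} (hN : 0 < N) (g : ℕ → ℝ) {y : ℝ}
    (hy : ∀ j, y ≠ (g (j - 1) + g j) / 2) : ∃ j < N, y ∈ cell N g j := by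
  have hex : ∃ j, (y : EReal) < hi N g j :=
    ⟨N - 1, by rw [hi, if_pos (by omega)]; exact EReal.coe_lt_top y⟩
  have hle : Nat.find hex ≤ N - 1 :=
    Nat.find_min' hex (by rw [hi, if_pos (by omega)]; exact EReal.coe_lt_top y)
  refine ⟨Nat.find hex, by omega, ?_, Nat.find_spec hex⟩
  unfold lo
  split_ifs with h0
  · exact EReal.bot_lt_coe y
  · have h1 := Nat.find_min hex (m := Nat.find hex - 1) (by omega)
    rw [hi, if_neg (by omega), Nat.sub_add_cancel (by omega), EReal.coe_lt_coe_iff, not_lt] at h1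
    rw [EReal.coe_lt_coe_iff]
    exact lt_of_le_of_ne h1 (hy _).symm

theorem measurableSet_cell (N : ℕ) (g : ℕ → ℝ) (j : ℕ) : MeasurableSet (cell N g j) :=
  (measurableSet_lt measurable_const measurable_coe_real_ereal).inter
    (measurableSet_lt measurable_coe_real_ereal measurable_const)

theorem gaussPi_real_pi {d : ℕ} (S : Fin d → Set ℝ) :
    (gaussPi d).real {z | ∀ ℓ, z ℓ ∈ S ℓ} = ∏ ℓ, (gaussianReal 0 1).real (S ℓ) := by
  have : {z : Fin d → ℝ | ∀ ℓ, z ℓ ∈ S ℓ} = Set.univ.pi S := by ext; simp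
  rw [this, measureReal_def, gaussPi, Measure.pi_pi, ENNReal.toReal_prod]
  rfl

theorem measurePreserving_eval_gaussPi {d : ℕ} (ℓ : Fin d) :
    MeasurePreserving (fun z : Fin d → ℝ => z ℓ) (gaussPi d) (gaussianReal 0 1) :=
  measurePreserving_eval (fun _ : Fin d => gaussianReal 0 1) ℓ

/-- Outside a null set an affine image of a standard Gaussian coordinate hits no half-point. -/
theorem ae_affine_ne_halfPoint {d : ℕ} (m v : Fin d → ℝ) (hv : ∀ ℓ, 0 < v ℓ)
    (g : Fin d → ℕ → ℝ) :
    ∀ᵐ z ∂gaussPi d, ∀ ℓ j, m ℓ + v ℓ * z ℓ ≠ (g ℓ (j - 1) + g ℓ j) / 2 := by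
  have : NullSingletonClass (gaussianReal 0 1) := nullSingletonClass_gaussianReal one_ne_zero
  rw [ae_all_iff]
  intro ℓ
  rw [ae_all_iff]
  intro j
  have h : ∀ᵐ x ∂gaussianReal 0 1, x ≠ ((g ℓ (j - 1) + g ℓ j) / 2 - m ℓ) / v ℓ :=
    Measure.ae_ne _ _
  filter_upwards [(measurePreserving_eval_gaussPi ℓ).quasiMeasurePreserving.ae h] with z hz he
  apply hz
  rw [eq_div_iff (hv ℓ).ne']
  linarith

end MPQ

/-- If `q = d` and the volatility matrix is diagonal with positive diagonal
entries, the transition probabilities of the Markovian product quantization factorize as the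
product of the marginal ones, each given by a difference of Gaussian cdfs; the companion
weights follow by summing over `i ∈ I_k`. -/
theorem statement_3
    {Ω : Type*} [MeasureSpace Ω] [IsProbabilityMeasure (ℙ : Measure Ω)]
    (d n : ℕ) (hd : 0 < d) (hn : 0 < n)
    (T Δ : ℝ) (hT : 0 < T) (hΔ : Δ = T / n)
    (b : ℕ → (Fin d → ℝ) → Fin d → ℝ)
    (σm : ℕ → (Fin d → ℝ) → Fin d → Fin d → ℝ)
    (N : ℕ → Fin d → ℕ) (hN : ∀ k ℓ, 0 < N k ℓ)
    (grid : ℕ → Fin d → ℕ → ℝ)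
    (hgrid : ∀ k ℓ, StrictMonoOn (grid k ℓ) {j | j < N k ℓ})
    (Z : ℕ → Ω → Fin d → ℝ) (hZmeas : ∀ k, Measurable (Z k))
    (hZlaw : ∀ k, Measure.map (Z (k + 1)) ℙ = gaussPi d)
    (Xtil Xhat : ℕ → Ω → Fin d → ℝ)
    (hXtilmeas : ∀ k, Measurable (Xtil k)) (hXhatmeas : ∀ k, Measurable (Xhat k))
    (hindep : ∀ k, IndepFun (Xhat k) (Z (k + 1)) ℙ)
    (hX0 : Xtil 0 = Xhat 0)
    (hrec : ∀ k ω ℓ, Xtil (k + 1) ω ℓ =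
      Xhat k ω ℓ + Δ * b k (Xhat k ω) ℓ +
        Real.sqrt Δ * ∑ p, σm k (Xhat k ω) ℓ p * Z (k + 1) ω p)
    (hproj : ∀ k ω ℓ j, j < N k ℓ →
      Xtil k ω ℓ ∈ cell (N k ℓ) (grid k ℓ) j → Xhat k ω ℓ = grid k ℓ j)
    (hran : ∀ k ω ℓ, ∃ j, j < N k ℓ ∧ Xhat k ω ℓ = grid k ℓ j)
    -- diagonal volatility with positive diagonal entries
    (hdiag : ∀ k x ℓ p, ℓ ≠ p → σm k x ℓ p = 0)
    (hdpos : ∀ k x ℓ, 0 < σm k x ℓ ℓ)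
    -- data of the statement
    (k : ℕ) (hk : k < n)
    (xk : ((ℓ' : Fin d) → Fin (N k ℓ')) → Fin d → ℝ)
    (hxk : ∀ i, xk i = fun ℓ' => grid k ℓ' (i ℓ' : ℕ))
    (xk1 : ((ℓ' : Fin d) → Fin (N (k + 1) ℓ')) → Fin d → ℝ)
    (hxk1 : ∀ j, xk1 j = fun ℓ' => grid (k + 1) ℓ' (j ℓ' : ℕ))
    (G : ((ℓ' : Fin d) → Fin (N k ℓ')) → ((ℓ' : Fin d) → Fin (N (k + 1) ℓ')) → Fin d → ℝ)
    (hG : ∀ i j ℓ, G i j ℓ =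
      Phi0E (affE (hi (N (k + 1) ℓ) (grid (k + 1) ℓ) (j ℓ : ℕ))
          (xk i ℓ + Δ * b k (xk i) ℓ) (Real.sqrt Δ * σm k (xk i) ℓ ℓ))
        - Phi0E (affE (lo (grid (k + 1) ℓ) (j ℓ : ℕ))
          (xk i ℓ + Δ * b k (xk i) ℓ) (Real.sqrt Δ * σm k (xk i) ℓ ℓ))) :
    (∀ i, 0 < pr {ω | Xhat k ω = xk i} → ∀ j,
      condPr {ω | Xhat (k + 1) ω = xk1 j} {ω | Xhat k ω = xk i}
        = ∏ ℓ, condPr {ω | Xhat (k + 1) ω ℓ = grid (k + 1) ℓ (j ℓ : ℕ)}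
            {ω | Xhat k ω = xk i}
      ∧ condPr {ω | Xhat (k + 1) ω = xk1 j} {ω | Xhat k ω = xk i} = ∏ ℓ, G i j ℓ)
    ∧ (∀ j, pr {ω | Xhat (k + 1) ω = xk1 j}
        = ∑ i : (ℓ' : Fin d) → Fin (N k ℓ'),
            (∏ ℓ, G i j ℓ) * pr {ω | Xhat k ω = xk i}) := by
  have hΔpos : 0 < Δ := by rw [hΔ]; positivity
  let m : ((ℓ' : Fin d) → Fin (N k ℓ')) → Fin d → ℝ := fun i ℓ => xk i ℓ + Δ * b k (xk i) ℓ
  let v : ((ℓ' : Fin d) → Fin (N k ℓ')) → Fin d → ℝ := fun i ℓ => √Δ * σm k (xk i) ℓ ℓ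
  have hv : ∀ i ℓ, 0 < v i ℓ := fun i ℓ => mul_pos (Real.sqrt_pos.2 hΔpos) (hdpos _ _ _)
  let S : ((ℓ' : Fin d) → Fin (N k ℓ')) → ((ℓ' : Fin d) → Fin (N (k + 1) ℓ')) → Fin d → Set ℝ :=
    fun i j ℓ => {z | m i ℓ + v i ℓ * z ∈ cell (N (k + 1) ℓ) (grid (k + 1) ℓ) (j ℓ)}
  have hSmeas : ∀ i j ℓ, MeasurableSet (S i j ℓ) := fun i j ℓ =>
    (measurableSet_cell _ _ _).preimage (by fun_prop : Measurable fun z => m i ℓ + v i ℓ * z)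
  have hSG : ∀ i j ℓ, (gaussianReal 0 1).real (S i j ℓ) = G i j ℓ := fun i j ℓ => by
    rw [hG]
    exact gaussianReal_affine_cell (hgrid _ _) (j ℓ).2 _ (hv i ℓ)
  have htil : ∀ i ω, Xhat k ω = xk i → ∀ ℓ, Xtil (k + 1) ω ℓ = m i ℓ + v i ℓ * Z (k + 1) ω ℓ := by
    intro i ω hω ℓ
    rw [hrec, hω, Finset.sum_eq_single ℓ]
    · simp only [m, v]; ring
    · intro p _ hp
      rw [hdiag _ _ _ _ hp.symm, zero_mul]
    · simp
  have hae : ∀ i, ∀ᵐ ω, Xhat k ω = xk i → ∀ j ℓ,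
      (Xhat (k + 1) ω ℓ = grid (k + 1) ℓ (j ℓ : ℕ) ↔ Z (k + 1) ω ℓ ∈ S i j ℓ) := by
    intro i
    have h := ae_affine_ne_halfPoint (m i) (v i) (hv i) (grid (k + 1))
    rw [← hZlaw k] at h
    filter_upwards [ae_of_ae_map (hZmeas _).aemeasurable h] with ω hω hB j ℓ
    constructor
    · intro hX
      obtain ⟨j', hj', hc⟩ := exists_mem_cell (hN (k + 1) ℓ) (grid (k + 1) ℓ) (hω ℓ)
      have h1 := hproj (k + 1) ω ℓ j' hj' (by rw [htil i ω hB]; exact hc)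
      have h2 : j' = j ℓ := (hgrid (k + 1) ℓ).injOn hj' (j ℓ).2 (h1.symm.trans hX)
      rw [h2] at hc
      exact hc
    · intro hz
      exact hproj (k + 1) ω ℓ _ (j ℓ).2 (by rw [htil i ω hB]; exact hz)
  have hind : ∀ i (C : Set (Fin d → ℝ)), MeasurableSet C →
      pr ({ω | Z (k + 1) ω ∈ C} ∩ {ω | Xhat k ω = xk i})
        = (gaussPi d).real C * pr {ω | Xhat k ω = xk i} := by
    intro i C hC
    have h := (hindep k).measure_inter_preimage_eq_mul {xk i} C (measurableSet_singleton _) hC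
    rw [Set.inter_comm] at h
    rw [← hZlaw k, measureReal_def, Measure.map_apply (hZmeas _) hC, mul_comm, pr, pr,
      ← ENNReal.toReal_mul]
    exact congrArg ENNReal.toReal h
  have hjoint : ∀ i j, pr ({ω | Xhat (k + 1) ω = xk1 j} ∩ {ω | Xhat k ω = xk i})
      = (∏ ℓ, G i j ℓ) * pr {ω | Xhat k ω = xk i} := by
    intro i j
    have hC : MeasurableSet {z : Fin d → ℝ | ∀ ℓ, z ℓ ∈ S i j ℓ} := by
      rw [Set.ofPred_forall]
      exact MeasurableSet.iInter fun ℓ => measurable_pi_apply ℓ (hSmeas i j ℓ)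
    have h := hind i _ hC
    rw [gaussPi_real_pi, Finset.prod_congr rfl fun ℓ _ => hSG i j ℓ] at h
    rw [← h]
    refine measureReal_congr ?_
    filter_upwards [hae i] with ω hω
    refine propext (and_congr_left fun hB => ?_)
    rw [mem_ofPred_eq, hxk1, funext_iff]
    exact forall_congr' fun ℓ => hω hB j ℓ
  have hmarg : ∀ i j ℓ,
      pr ({ω | Xhat (k + 1) ω ℓ = grid (k + 1) ℓ (j ℓ : ℕ)} ∩ {ω | Xhat k ω = xk i})
        = G i j ℓ * pr {ω | Xhat k ω = xk i} := by
    intro i j ℓ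
    have h := hind i _ (measurable_pi_apply ℓ (hSmeas i j ℓ))
    rw [(measurePreserving_eval_gaussPi ℓ).measureReal_preimage
      (hSmeas i j ℓ).nullMeasurableSet, hSG] at h
    rw [← h]
    refine measureReal_congr ?_
    filter_upwards [hae i] with ω hω
    exact propext (and_congr_left fun hB => hω hB j ℓ)
  refine ⟨fun i hi j => ?_, fun j => ?_⟩
  · have h1 : condPr {ω | Xhat (k + 1) ω = xk1 j} {ω | Xhat k ω = xk i} = ∏ ℓ, G i j ℓ := by
      rw [condPr, hjoint, mul_div_cancel_right₀ _ hi.ne']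
    refine ⟨h1.trans (Finset.prod_congr rfl fun ℓ _ => ?_), h1⟩
    rw [condPr, hmarg, mul_div_cancel_right₀ _ hi.ne']
  · rw [← Finset.sum_congr rfl fun i _ => hjoint i j]
    have hmA : MeasurableSet {ω | Xhat (k + 1) ω = xk1 j} :=
      hXhatmeas (k + 1) (measurableSet_singleton (xk1 j))
    have hmB : ∀ i, MeasurableSet {ω | Xhat k ω = xk i} := fun i =>
      hXhatmeas k (measurableSet_singleton (xk i))
    have hinj : Function.Injective xk := by
      intro i i' h
      rw [hxk, hxk] at h
      funext ℓ
      exact Fin.ext ((hgrid k ℓ).injOn (i ℓ).2 (i' ℓ).2 (congrFun h ℓ))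
    have hcover : {ω | Xhat (k + 1) ω = xk1 j}
        = ⋃ i, {ω | Xhat (k + 1) ω = xk1 j} ∩ {ω | Xhat k ω = xk i} := by
      rw [← Set.inter_iUnion, eq_comm, Set.inter_eq_left]
      intro ω _
      choose f hf hfe using hran k ω
      refine mem_iUnion.2 ⟨fun ℓ => ⟨f ℓ, hf ℓ⟩, ?_⟩
      rw [mem_ofPred_eq, hxk]
      exact funext hfe
    conv_lhs => rw [hcover]
    refine measureReal_iUnion_fintype (fun i i' hne => ?_) fun i => hmA.inter (hmB i)
    refine Set.disjoint_left.2 fun ω h h' => hne (hinj ?_)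
    exact h.2.symm.trans h'.2
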